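/- Let (X_i)_{i∈I} and (Y_j)_{j∈J} be two families of random elements of a partially ordered Polish space X with closed partial order, with I and J countable. Suppose that for all finite subsets I' ⊂ I and J' ⊂ J and all bounded measurable coordinatewise nondecreasing functions f : X^{I'} → ℝ and g : X^{J'} → ℝ, E[f(X_{I'}) g(Y_{J'})] ≥ E[f(X_{I'})] E[g(Y_{J'})]. Then for all bounded measurable coordinatewise nondecreasing functions f : X^I → ℝ and g : X^J → ℝ, E[f(X_I) g(Y_J)] ≥ E[f(X_I)] E[g(Y_J)]. -/

import Mathlib

open MeasureTheory Set Filter Topology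

theorem IsCompact.isClosed_upperClosure {X : Type*} [TopologicalSpace X] [Preorder X]
    [OrderClosedTopology X] {K : Set X} (hK : IsCompact K) :
    IsClosed (upperClosure K : Set X) := by
  have : CompactSpace K := isCompact_iff_compactSpace.mp hK
  have h : IsClosed {p : K × X | (p.1 : X) ≤ p.2} :=
    isClosed_le (by fun_prop) (by fun_prop)
  convert isClosedMap_snd_of_compactSpace _ h using 1
  ext x
  simp [mem_upperClosure]

/-- The upper closure of a compact set in a product is determined by the upper closures of its
finite-dimensional projections. -/
theorem IsCompact.upperClosure_eq_iInter_restrict {ι X : Type*} [TopologicalSpace X] [Preorder X]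
    [OrderClosedTopology X] {K : Set (ι → X)} (hK : IsCompact K) :
    (upperClosure K : Set (ι → X)) =
      ⋂ s : Finset ι, s.restrict ⁻¹' (upperClosure (s.restrict '' K) : Set (s → X)) := by
  classical
  ext x
  simp only [SetLike.mem_coe, mem_upperClosure, mem_iInter, mem_preimage, exists_mem_image]
  constructor
  · rintro ⟨k, hk, hkx⟩ s
    exact ⟨k, hk, fun i => hkx i⟩
  · intro h
    obtain ⟨k, hk, hkx⟩ := hK.inter_iInter_nonempty (fun i => {k : ι → X | k i ≤ x i})
      (fun i => isClosed_le (continuous_apply i) continuous_const) (fun s => by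
        obtain ⟨k, hk, hkx⟩ := h s
        exact ⟨k, hk, mem_iInter₂.mpr fun i hi => hkx ⟨i, hi⟩⟩)
    exact ⟨k, hk, fun i => mem_iInter.mp hkx i⟩

section Weighted

variable {Ω : Type*} [MeasurableSpace Ω] {P : Measure Ω} {w : Ω → ℝ}

/-- A nonnegative bounded function differs by at most one from a sum of indicators of
superlevel sets. -/
theorem neg_integral_abs_le_integral_mul {h : Ω → ℝ} (hw : Integrable w P)
    (hh : Measurable h) (h0 : ∀ ω, 0 ≤ h ω) {C : ℝ} (hC : ∀ ω, h ω ≤ C)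
    (hset : ∀ t : ℝ, 0 ≤ ∫ ω in {ω | t ≤ h ω}, w ω ∂P) :
    -∫ ω, |w ω| ∂P ≤ ∫ ω, h ω * w ω ∂P := by
  have hm : ∀ t : ℝ, MeasurableSet {ω | t ≤ h ω} := fun t => measurableSet_le measurable_const hh
  have hfloor : ∀ ω, (⌊h ω⌋₊ : ℝ) * w ω =
      ∑ k ∈ Finset.range ⌊C⌋₊, {ω | ((k + 1 : ℕ) : ℝ) ≤ h ω}.indicator w ω := by
    intro ω
    have hle : ⌊h ω⌋₊ ≤ ⌊C⌋₊ := Nat.floor_mono (hC ω)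
    have hfil : (Finset.range ⌊C⌋₊).filter (fun k => ((k + 1 : ℕ) : ℝ) ≤ h ω) =
        Finset.range ⌊h ω⌋₊ := by
      ext k
      simp only [Finset.mem_filter, Finset.mem_range, ← Nat.le_floor_iff (h0 ω)]
      omega
    simp only [indicator_apply, mem_ofPred_eq]
    rw [← Finset.sum_filter, hfil]
    simp
  have hnn : 0 ≤ ∫ ω, (⌊h ω⌋₊ : ℝ) * w ω ∂P := by
    simp_rw [hfloor]
    rw [integral_finsetSum _ fun k _ => hw.indicator (hm _)]
    refine Finset.sum_nonneg fun k _ => ?_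
    rw [integral_indicator (hm _)]
    exact hset _
  have hint1 : Integrable (fun ω => (⌊h ω⌋₊ : ℝ) * w ω) P := by
    simp_rw [hfloor]
    exact integrable_finsetSum _ fun k _ => hw.indicator (hm _)
  have hint2 : Integrable (fun ω => h ω * w ω) P :=
    hw.bdd_mul (c := C) hh.aestronglyMeasurable
      (ae_of_all _ fun ω => by rw [Real.norm_eq_abs, abs_of_nonneg (h0 ω)]; exact hC ω)
  have hdiff : ∫ ω, ((⌊h ω⌋₊ : ℝ) * w ω - h ω * w ω) ∂P ≤ ∫ ω, |w ω| ∂P := by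
    refine integral_mono (hint1.sub hint2) hw.abs fun ω => ?_
    have h1 := Nat.floor_le (h0 ω)
    have h2 := (Nat.lt_floor_add_one (h ω)).le
    calc (⌊h ω⌋₊ : ℝ) * w ω - h ω * w ω ≤ |((⌊h ω⌋₊ : ℝ) - h ω) * w ω| := by
          rw [← sub_mul]; exact le_abs_self _
      _ = |(⌊h ω⌋₊ : ℝ) - h ω| * |w ω| := abs_mul _ _
      _ ≤ 1 * |w ω| := by
          gcongr
          rw [abs_le]
          constructor <;> linarith
      _ = |w ω| := one_mul _
  rw [integral_sub hint1 hint2] at hdiff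
  linarith

/-- If a centered weight has nonnegative integral over all superlevel sets of a bounded function,
then it has nonnegative integral against this function. -/
theorem integral_mul_nonneg_of_superlevel {h : Ω → ℝ} (hw : Integrable w P)
    (hw0 : ∫ ω, w ω ∂P = 0) (hh : Measurable h) {C : ℝ} (hC : ∀ ω, |h ω| ≤ C)
    (hset : ∀ t : ℝ, 0 ≤ ∫ ω in {ω | t ≤ h ω}, w ω ∂P) :
    0 ≤ ∫ ω, h ω * w ω ∂P := by
  have hint : Integrable (fun ω => h ω * w ω) P :=
    hw.bdd_mul (c := C) hh.aestronglyMeasurable (ae_of_all _ hC)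
  have key : ∀ n : ℕ, -∫ ω, |w ω| ∂P ≤ (n + 1 : ℝ) * ∫ ω, h ω * w ω ∂P := by
    intro n
    have hn : (0 : ℝ) < n + 1 := by positivity
    have := neg_integral_abs_le_integral_mul (h := fun ω => (n + 1 : ℝ) * (h ω + C))
      (C := (n + 1 : ℝ) * (C + C)) hw (by fun_prop)
      (fun ω => mul_nonneg hn.le (by linarith [(abs_le.mp (hC ω)).1]))
      (fun ω => mul_le_mul_of_nonneg_left (by linarith [(abs_le.mp (hC ω)).2]) hn.le)
      (fun t => by
        convert hset (t / (n + 1) - C) using 5 with ω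
        rw [sub_le_iff_le_add, div_le_iff₀' hn])
    have heq : ∀ ω, (n + 1 : ℝ) * (h ω + C) * w ω =
        (n + 1 : ℝ) * (h ω * w ω) + (n + 1 : ℝ) * C * w ω := fun ω => by ring
    simp_rw [heq] at this
    rwa [integral_add (hint.const_mul _) (hw.const_mul _), integral_const_mul,
      integral_const_mul, hw0, mul_zero, add_zero] at this
  by_contra! hneg
  obtain ⟨n, hn⟩ := exists_nat_gt ((∫ ω, |w ω| ∂P) / -∫ ω, h ω * w ω ∂P)
  rw [div_lt_iff₀ (by linarith)] at hn
  have := key n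
  nlinarith

variable {ι X : Type*} [Countable ι] [TopologicalSpace X] [PolishSpace X] [MeasurableSpace X]
  [BorelSpace X] [PartialOrder X] [OrderClosedTopology X] {Z : ι → Ω → X}

/-- If a bounded weight has nonnegative integral over all closed upper events depending on finitely
many coordinates, then it has nonnegative integral over all measurable upper events. -/
theorem setIntegral_nonneg_of_finite_isUpperSet [IsFiniteMeasure P] (hw : Integrable w P) {C : ℝ}
    (hC : ∀ ω, |w ω| ≤ C) (hZ : ∀ i, Measurable (Z i))
    (hfin : ∀ (s : Finset ι) (U : Set (s → X)), IsClosed U → IsUpperSet U →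
      0 ≤ ∫ ω in (fun ω (i : s) => Z i ω) ⁻¹' U, w ω ∂P)
    {A : Set (ι → X)} (hA : MeasurableSet A) (hup : IsUpperSet A) :
    0 ≤ ∫ ω in (fun ω i => Z i ω) ⁻¹' A, w ω ∂P := by
  have hZm : Measurable fun ω i => Z i ω := measurable_pi_lambda _ hZ
  have hcompact : ∀ K : Set (ι → X), IsCompact K →
      0 ≤ ∫ ω in (fun ω i => Z i ω) ⁻¹' (upperClosure K : Set (ι → X)), w ω ∂P := by
    intro K hK
    have hcl : ∀ s : Finset ι, IsClosed (upperClosure (s.restrict '' K) : Set (s → X)) :=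
      fun s => (hK.image (by fun_prop)).isClosed_upperClosure
    rw [hK.upperClosure_eq_iInter_restrict, preimage_iInter]
    refine ge_of_tendsto' (tendsto_setIntegral_of_antitone (fun s => ?_) (fun s t hst ω => ?_)
      ⟨∅, hw.integrableOn⟩) fun s => hfin s _ (hcl s) (upperClosure _).upper
    · exact hZm ((Finset.measurable_restrict s) (hcl s).measurableSet)
    · simp only [mem_preimage, SetLike.mem_coe, mem_upperClosure, exists_mem_image]
      rintro ⟨k, hk, hkx⟩
      exact ⟨k, hk, fun i => hkx ⟨i, hst i.2⟩⟩
  have hC1 : 0 < |C| + 1 := by positivity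
  refine le_of_forall_pos_le_add fun ε hε => ?_
  obtain ⟨K, hKA, hK, hlt⟩ := hA.exists_isCompact_sdiff_lt (μ := P.map fun ω i => Z i ω)
    (measure_ne_top _ _) (ε := ENNReal.ofReal (ε / (|C| + 1)))
    (by simpa using div_pos hε hC1)
  have hUA : (upperClosure K : Set (ι → X)) ⊆ A := upperClosure_min hKA hup
  have hUm : MeasurableSet (upperClosure K : Set (ι → X)) := hK.isClosed_upperClosure.measurableSet
  have hsmall : P.real ((fun ω i => Z i ω) ⁻¹' (A \ upperClosure K)) ≤ ε / (|C| + 1) := by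
    refine ENNReal.toReal_le_of_le_ofReal (by positivity) ?_
    rw [← Measure.map_apply hZm (hA.diff hUm)]
    exact (measure_mono (sdiff_subset_sdiff_right subset_upperClosure)).trans hlt.le
  have hbound : |∫ ω in (fun ω i => Z i ω) ⁻¹' (A \ upperClosure K), w ω ∂P| ≤ ε := by
    calc _ ≤ (|C| + 1) * P.real ((fun ω i => Z i ω) ⁻¹' (A \ upperClosure K)) :=
          norm_setIntegral_le_of_norm_le_const (f := w) (measure_lt_top _ _)
            fun ω _ => (hC ω).trans (by linarith [le_abs_self C])
      _ ≤ (|C| + 1) * (ε / (|C| + 1)) := by gcongr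
      _ = ε := by field_simp
  have hsplit := setIntegral_sdiff (hZm hUm) hw.integrableOn (preimage_mono hUA) (μ := P)
  rw [← preimage_sdiff] at hsplit
  linarith [hcompact K hK, (abs_le.mp hbound).1]

/-- If a bounded centered weight has nonnegative integral against all bounded nondecreasing
functions of finitely many coordinates, then the same holds for all bounded nondecreasing
functions of the whole family. -/
theorem integral_monotone_mul_nonneg_of_finite [IsFiniteMeasure P] (hw : Integrable w P) {C : ℝ}
    (hC : ∀ ω, |w ω| ≤ C) (hw0 : ∫ ω, w ω ∂P = 0) (hZ : ∀ i, Measurable (Z i))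
    (hfin : ∀ (s : Finset ι) (f : (s → X) → ℝ), Measurable f → Monotone f →
      (∃ C, ∀ x, |f x| ≤ C) → 0 ≤ ∫ ω, f (fun i => Z i ω) * w ω ∂P)
    {f : (ι → X) → ℝ} (hf : Measurable f) (hmono : Monotone f) (hbdd : ∃ C, ∀ x, |f x| ≤ C) :
    0 ≤ ∫ ω, f (fun i => Z i ω) * w ω ∂P := by
  obtain ⟨D, hD⟩ := hbdd
  refine integral_mul_nonneg_of_superlevel hw hw0 (hf.comp (measurable_pi_lambda _ hZ))
    (fun ω => hD _) fun t => ?_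
  refine setIntegral_nonneg_of_finite_isUpperSet hw hC hZ (fun s U hU hup => ?_)
    (A := {x | t ≤ f x}) (measurableSet_le measurable_const hf)
    fun x y hxy hx => le_trans hx (hmono hxy)
  have hUm : Measurable (U.indicator (1 : (s → X) → ℝ)) :=
    measurable_one.indicator hU.measurableSet
  have := hfin s (U.indicator 1) hUm
    (fun x y hxy => by
      by_cases hx : x ∈ U
      · simp [hx, hup hxy hx]
      · rw [indicator_of_notMem hx]
        exact indicator_nonneg (fun _ _ => zero_le_one) _)
    ⟨1, fun x => by by_cases hx : x ∈ U <;> simp [hx]⟩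
  rw [← integral_indicator ((measurable_pi_lambda _ fun i : s => hZ i) hU.measurableSet)]
  refine this.trans_eq (integral_congr_ae (ae_of_all _ fun ω => ?_))
  by_cases hx : (fun i : s => Z i ω) ∈ U <;> simp [indicator, hx]

end Weighted

/-- The covariance inequality for bounded random variables, with one factor centered. -/
theorem integral_mul_integral_le_iff {Ω : Type*} [MeasurableSpace Ω] {P : Measure Ω}
    {u v : Ω → ℝ} (hu : Integrable u P) (huv : Integrable (fun ω => u ω * v ω) P) :
    (∫ ω, u ω ∂P) * ∫ ω, v ω ∂P ≤ ∫ ω, u ω * v ω ∂P ↔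
      0 ≤ ∫ ω, u ω * (v ω - ∫ ω', v ω' ∂P) ∂P := by
  simp_rw [mul_sub]
  rw [integral_sub huv (hu.mul_const _), integral_mul_const, sub_nonneg]

/-- Positive covariance with a fixed bounded random variable passes from finite subfamilies to a
countable family. -/
theorem integral_mul_integral_le_of_finite {Ω ι X : Type*} [MeasurableSpace Ω] [Countable ι]
    [TopologicalSpace X] [PolishSpace X] [MeasurableSpace X] [BorelSpace X]
    [PartialOrder X] [OrderClosedTopology X] {P : Measure Ω} [IsProbabilityMeasure P]
    {Z : ι → Ω → X} (hZ : ∀ i, Measurable (Z i)) {v : Ω → ℝ} (hv : Measurable v)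
    (hvb : ∃ C, ∀ ω, |v ω| ≤ C)
    (hfin : ∀ (s : Finset ι) (f : (s → X) → ℝ), Measurable f → Monotone f →
      (∃ C, ∀ x, |f x| ≤ C) →
      (∫ ω, f (fun i => Z i ω) ∂P) * ∫ ω, v ω ∂P ≤ ∫ ω, f (fun i => Z i ω) * v ω ∂P)
    {f : (ι → X) → ℝ} (hf : Measurable f) (hmono : Monotone f) (hbdd : ∃ C, ∀ x, |f x| ≤ C) :
    (∫ ω, f (fun i => Z i ω) ∂P) * ∫ ω, v ω ∂P ≤ ∫ ω, f (fun i => Z i ω) * v ω ∂P := by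
  obtain ⟨C, hC⟩ := hvb
  have hvi : Integrable v P := .of_bound hv.aestronglyMeasurable C (ae_of_all _ hC)
  have hint : ∀ {u : Ω → ℝ}, Measurable u → (∃ D, ∀ ω, |u ω| ≤ D) →
      Integrable u P ∧ Integrable (fun ω => u ω * v ω) P := fun hu ⟨D, hD⟩ =>
    ⟨.of_bound hu.aestronglyMeasurable D (ae_of_all _ hD),
      hvi.bdd_mul (c := D) hu.aestronglyMeasurable (ae_of_all _ hD)⟩
  have hfi := hint (hf.comp (measurable_pi_lambda (fun ω i => Z i ω) hZ))
    (hbdd.imp fun D hD ω => hD _)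
  refine (integral_mul_integral_le_iff hfi.1 hfi.2).mpr ?_
  refine integral_monotone_mul_nonneg_of_finite (C := C + |∫ ω, v ω ∂P|)
    (hvi.sub (integrable_const _)) (fun ω => (abs_sub _ _).trans (by gcongr; exact hC ω)) ?_ hZ
    (fun s f hf hmono hbdd => ?_) hf hmono hbdd
  · rw [integral_sub' hvi (integrable_const _)]
    simp
  · have hfi := hint (hf.comp (measurable_pi_lambda (fun ω (i : s) => Z i ω) fun i => hZ i))
      (hbdd.imp fun D hD ω => hD _)
    exact (integral_mul_integral_le_iff hfi.1 hfi.2).mp (hfin s f hf hmono hbdd)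

/-- If two countable families `(Xs i)_{i ∈ ι}`, `(Ys j)_{j ∈ κ}` of random elements of a
partially ordered Polish space with closed partial order satisfy the positive covariance
inequality `E[f(X_{I'}) g(Y_{J'})] ≥ E[f(X_{I'})] E[g(Y_{J'})]` for all finite subsets
`I' ⊆ ι`, `J' ⊆ κ` and all bounded measurable coordinatewise nondecreasing `f`, `g`,
then the same inequality holds for the full (countable) families. -/
theorem posAssoc_two_families_of_finite
    {Ω ι κ X : Type*} [MeasurableSpace Ω] [Countable ι] [Countable κ]
    [TopologicalSpace X] [PolishSpace X] [MeasurableSpace X] [BorelSpace X]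
    [PartialOrder X] [OrderClosedTopology X]
    (P : Measure Ω) [IsProbabilityMeasure P]
    (Xs : ι → Ω → X) (Ys : κ → Ω → X)
    (hXmeas : ∀ i, Measurable (Xs i)) (hYmeas : ∀ j, Measurable (Ys j))
    (hfin : ∀ (I' : Finset ι) (J' : Finset κ)
        (f : (I' → X) → ℝ) (g : (J' → X) → ℝ),
      Measurable f → Monotone f → (∃ C, ∀ x, |f x| ≤ C) →
      Measurable g → Monotone g → (∃ C, ∀ x, |g x| ≤ C) →
      (∫ ω, f (fun i => Xs i.1 ω) ∂P) * ∫ ω, g (fun j => Ys j.1 ω) ∂P ≤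
        ∫ ω, f (fun i => Xs i.1 ω) * g (fun j => Ys j.1 ω) ∂P) :
    ∀ (f : (ι → X) → ℝ) (g : (κ → X) → ℝ),
      Measurable f → Monotone f → (∃ C, ∀ x, |f x| ≤ C) →
      Measurable g → Monotone g → (∃ C, ∀ x, |g x| ≤ C) →
      (∫ ω, f (fun i => Xs i ω) ∂P) * ∫ ω, g (fun j => Ys j ω) ∂P ≤
        ∫ ω, f (fun i => Xs i ω) * g (fun j => Ys j ω) ∂P := by
  intro f g hf hfm hfb hg hgm hgb
  refine integral_mul_integral_le_of_finite hXmeas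
    (hg.comp (measurable_pi_lambda (fun ω j => Ys j ω) hYmeas))
    (hgb.imp fun C hC ω => hC _) (fun s f hf hfm hfb => ?_) hf hfm hfb
  have hu : Measurable fun ω => f fun i : s => Xs i ω :=
    hf.comp (measurable_pi_lambda _ fun i => hXmeas i)
  have := integral_mul_integral_le_of_finite (P := P) hYmeas hu
    (hfb.imp fun C hC ω => hC _) (fun t g hg hgm hgb => ?_) hg hgm hgb
  · simpa only [mul_comm, Function.comp_apply] using this
  · simpa only [mul_comm] using hfin s t f g hf hfm hfb hg hgm hgb
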